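/- arXiv:2504.12146 — 2 statements merged into one kernel-verified Lean document; each statement's English description precedes it below -/
import Mathlib

section
/- Let I ⊂ S = K[x_1,...,x_n] be a monomial ideal. Then proj dim(S/I) = n if and only if G(I) contains a dominant subset L of cardinality n such that no element of G(I) strongly divides lcm(L). -/
open CategoryTheory

/-- The projective dimension of a module `M` over `R`: the least `d` such that
`Ext^{d+1}(M, N) = 0` for all modules `N` (and `⊤` if no such `d` exists). -/
noncomputable def projDim (R : Type) [CommRing R] (M : ModuleCat R) : ℕ∞ :=
  sInf ((fun d : ℕ => (d : ℕ∞)) ''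
    {d : ℕ | ∀ N : ModuleCat R, Subsingleton (((Ext R (ModuleCat R) (d + 1)).obj
      (Opposite.op M)).obj N)})

open MvPolynomial

lemma old_ext_iff (R : Type) [CommRing R] (M N : ModuleCat.{0} R) (P : ProjectiveResolution M)
    (d : ℕ) :
    Subsingleton (((Ext R (ModuleCat R) (d + 1)).obj (Opposite.op M)).obj N) ↔
    ∀ f : P.complex.X (d+1) ⟶ N, P.complex.d (d+2) (d+1) ≫ f = 0 →
      ∃ g : P.complex.X d ⟶ N, P.complex.d (d+1) d ≫ g = f := by
  rw [← ModuleCat.isZero_iff_subsingleton, (P.isoExt (R := R) (d+1) N).isZero_iff,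
    ← HomologicalComplex.exactAt_iff_isZero_homology,
    HomologicalComplex.exactAt_iff' _ d (d+1) (d+2) (by simp) (by simp)]
  rw [ShortComplex.moduleCat_exact_iff]
  rfl

lemma new_ext_iff (R : Type) [CommRing R] (M N : ModuleCat.{0} R) (P : ProjectiveResolution M)
    (d : ℕ) :
    Subsingleton (Abelian.Ext.{0} M N (d+1)) ↔
    ∀ f : P.complex.X (d+1) ⟶ N, P.complex.d (d+2) (d+1) ≫ f = 0 →
      ∃ g : P.complex.X d ⟶ N, P.complex.d (d+1) d ≫ g = f := by
  constructor
  · intro h f hf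
    exact (P.extMk_eq_zero_iff f (d+2) rfl hf d rfl).1 (Subsingleton.elim _ _)
  · intro h
    refine subsingleton_of_forall_eq 0 fun α => ?_
    obtain ⟨f, hf, rfl⟩ := P.extMk_surjective α (d+2) rfl
    exact (P.extMk_eq_zero_iff f (d+2) rfl hf d rfl).2 (h f hf)

lemma old_iff_LT (R : Type) [CommRing R] (M : ModuleCat.{0} R) (d : ℕ) :
    (∀ N : ModuleCat.{0} R, Subsingleton (((Ext R (ModuleCat R) (d + 1)).obj
      (Opposite.op M)).obj N)) ↔ HasProjectiveDimensionLT M (d+1) := by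
  have P := projectiveResolution M
  simp_rw [fun N => (old_ext_iff R M N P d).trans (new_ext_iff R M N P d).symm]
  constructor
  · intro h
    exact hasProjectiveDimensionLT_of_enoughInjectives M (d+1) h
  · intro h N
    exact HasProjectiveDimensionLT.subsingleton M (d+1) (d+1) le_rfl N

lemma projDim_eq_iff (R : Type) [CommRing R] (M : ModuleCat.{0} R) (n : ℕ) (hn : 0 < n)
    (h : HasProjectiveDimensionLT M (n+1)) :
    projDim R M = n ↔ ¬ HasProjectiveDimensionLT M n := by
  obtain ⟨m, rfl⟩ : ∃ m, n = m + 1 := ⟨n-1, by omega⟩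
  unfold projDim
  simp_rw [old_iff_LT]
  constructor
  · intro h1 h2
    have : sInf ((fun d : ℕ => (d : ℕ∞)) '' {d : ℕ | HasProjectiveDimensionLT M (d + 1)}) ≤ (m : ℕ∞) :=
      sInf_le ⟨m, h2, rfl⟩
    rw [h1] at this
    norm_cast at this
    omega
  · intro h1
    apply le_antisymm
    · exact sInf_le ⟨m+1, h, rfl⟩
    · apply le_sInf
      rintro _ ⟨d, hd, rfl⟩
      simp only [Nat.cast_le]
      by_contra hlt
      have hd' : HasProjectiveDimensionLT M (d+1) := hd
      exact h1 (hasProjectiveDimensionLT_of_ge M (d+1) (m+1) (by omega))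

set_option linter.unusedSectionVars false

open TensorProduct in
lemma bc_shortExact {R A : Type} [CommRing R] [CommRing A] [Algebra R A] [Module.Flat R A]
    {M P N : Type} [AddCommGroup M] [Module R M] [AddCommGroup P] [Module R P]
    [AddCommGroup N] [Module R N] (f : N →ₗ[R] P) (g : P →ₗ[R] M)
    (hex : Function.Exact f g) (hf : Function.Injective f) (hg : Function.Surjective g)
    (hz : g.baseChange A ∘ₗ f.baseChange A = 0) :
    (ModuleCat.shortComplexOfCompEqZero (f.baseChange A) (g.baseChange A) hz).ShortExact := by
  have h1 : Function.Exact (f.lTensor A) (g.lTensor A) := lTensor_exact A hex hg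
  exact ModuleCat.shortComplex_shortExact _ h1
    (Module.Flat.lTensor_preserves_injective_linearMap f hf) (LinearMap.lTensor_surjective A hg)

open TensorProduct in
lemma pd_baseChange {R A : Type} [CommRing R] [CommRing A] [Algebra R A] [Module.Flat R A]
    (n : ℕ) (M : Type) [AddCommGroup M] [Module R M]
    (h : HasProjectiveDimensionLT (ModuleCat.of R M) (n+1)) :
    HasProjectiveDimensionLT (ModuleCat.of A (A ⊗[R] M)) (n+1) := by
  induction n generalizing M with
  | zero =>
    rw [zero_add, ← projective_iff_hasProjectiveDimensionLT_one,
      ← IsProjective.iff_projective] at h ⊢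
    infer_instance
  | succ n ih =>
    let π : (M →₀ R) →ₗ[R] M := Finsupp.linearCombination R id
    have hπ : Function.Surjective π := Finsupp.linearCombination_id_surjective R M
    have hS := LinearMap.shortExact_shortComplexKer hπ
    have hp : Projective (ModuleCat.of R (M →₀ R)) := inferInstance
    have h1 := (hS.hasProjectiveDimensionLT_X₃_iff n hp).1 h
    have h2 := ih _ h1
    have hex : Function.Exact (π.ker.subtype) π := π.exact_subtype_ker_map
    have hz : π.baseChange A ∘ₗ π.ker.subtype.baseChange A = 0 := by
      rw [← LinearMap.baseChange_comp, hex.linearMap_comp_eq_zero, LinearMap.baseChange_zero]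
    have hS' := bc_shortExact (R := R) (A := A) (M := M) (N := LinearMap.ker π) (P := M →₀ R)
      (LinearMap.ker π).subtype π hex (Submodule.injective_subtype _) hπ hz
    have hp' : Projective (ModuleCat.of A (A ⊗[R] (M →₀ R))) := inferInstance
    exact (hS'.hasProjectiveDimensionLT_X₃_iff n hp').2 h2

lemma pd_of_injective {R : Type} [CommRing R] {n : ℕ}
    (hg : ∀ M : ModuleCat.{0} R, HasProjectiveDimensionLT M (n+1))
    {M N : Type} [AddCommGroup M] [Module R M] [AddCommGroup N] [Module R N]
    (f : M →ₗ[R] N) (hf : Function.Injective f)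
    (h : HasProjectiveDimensionLT (ModuleCat.of R N) n) :
    HasProjectiveDimensionLT (ModuleCat.of R M) n := by
  have hS := ModuleCat.shortComplex_shortExact (ModuleCat.shortComplexOfCompEqZero
      f (LinearMap.range f).mkQ (LinearMap.range_mkQ_comp f))
      (LinearMap.exact_map_mkQ_range f) hf (Submodule.mkQ_surjective _)
  exact hS.hasProjectiveDimensionLT_X₁ n h (hg _)

section poly
open TensorProduct Polynomial

variable {R : Type} [CommRing R] (M : Type) [AddCommGroup M] [Module R M]
  [Module R[X] M] [IsScalarTower R R[X] M]

/-- multiplication by X on M, as R-linear -/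
noncomputable def mX : M →ₗ[R] M :=
  { toFun := fun m => (Polynomial.X : R[X]) • m
    map_add' := smul_add _
    map_smul' := fun r m => (smul_comm r _ m).symm }

noncomputable def dX : R[X] ⊗[R] M →ₗ[R[X]] R[X] ⊗[R] M :=
  (Polynomial.X : R[X]) • LinearMap.id - (mX (R := R) M).baseChange R[X]

noncomputable def eX : R[X] ⊗[R] M →ₗ[R[X]] M :=
  AlgebraTensorModule.lift
    (
      { toFun := fun p => { toFun := fun m => p • m, map_add' := smul_add _,
                            map_smul' := fun r m => (smul_comm r _ m).symm }
        map_add' := fun p q => by ext m; simp [add_smul]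
        map_smul' := fun p q => by ext m; simp [mul_smul] })

lemma dX_tmul (p : R[X]) (m : M) :
    dX M (p ⊗ₜ m) = (Polynomial.X * p) ⊗ₜ[R] m - p ⊗ₜ[R] ((Polynomial.X : R[X]) • m) := by
  simp [dX, mX, TensorProduct.smul_tmul']

lemma eX_tmul (p : R[X]) (m : M) : eX (R := R) M (p ⊗ₜ m) = p • m := by
  simp [eX]

noncomputable def hX : R[X] ⊗[R] M →ₗ[R] R[X] ⊗[R] M :=
  TensorProduct.lift ((Polynomial.basisMonomials R).constr R (fun k =>
    ∑ i ∈ Finset.range k,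
      (TensorProduct.mk R R[X] M (Polynomial.X ^ (k - 1 - i))) ∘ₗ ((mX (R := R) M) ^ i)))

lemma hX_tmul (k : ℕ) (m : M) :
    hX M (((Polynomial.X : R[X]) ^ k) ⊗ₜ m) = 
    ∑ i ∈ Finset.range k, (Polynomial.X ^ (k - 1 - i) : R[X]) ⊗ₜ[R] ((Polynomial.X ^ i : R[X]) • m) := by
  have h1 : ((Polynomial.X : R[X]) ^ k) = Polynomial.basisMonomials R k := by
    simp [Polynomial.X_pow_eq_monomial]
  have h2 : ∀ i (m : M), ((mX (R := R) M) ^ i) m = (Polynomial.X ^ i : R[X]) • m := by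
    intro i m
    induction i with
    | zero => simp
    | succ i ih => rw [pow_succ', Module.End.mul_apply, ih, pow_succ', mul_smul]; rfl
  rw [hX, TensorProduct.lift.tmul, h1, Module.Basis.constr_basis]
  simp [LinearMap.sum_apply, h2]

lemma hX_dX (t : R[X] ⊗[R] M) : hX M (dX M t) = t := by
  have : (hX (R := R) M) ∘ₗ (dX (R := R) M).restrictScalars R = LinearMap.id := by
    apply TensorProduct.ext
    apply (Polynomial.basisMonomials R).ext
    intro k
    ext m
    have h1 : Polynomial.basisMonomials R k = ((Polynomial.X : R[X]) ^ k) := by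
      simp [Polynomial.X_pow_eq_monomial]
    rw [h1]
    change hX M (dX M (((Polynomial.X : R[X]) ^ k) ⊗ₜ m)) = ((Polynomial.X : R[X]) ^ k) ⊗ₜ m
    rw [dX_tmul, map_sub, ← pow_succ', hX_tmul, hX_tmul, Finset.sum_range_succ']
    have : ∀ i, k - (i+1) = k - 1 - i := fun i => by omega
    have h5 : ∀ i ∈ Finset.range k,
        (Polynomial.X ^ (k + 1 - 1 - (i + 1)) : R[X]) ⊗ₜ[R] ((Polynomial.X ^ (i + 1) : R[X]) • m) =
        (Polynomial.X ^ (k - 1 - i) : R[X]) ⊗ₜ[R]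
          ((Polynomial.X ^ i : R[X]) • (Polynomial.X : R[X]) • m) := by
      intro i _
      rw [Nat.add_sub_cancel, this, ← mul_smul, ← pow_succ]
    rw [Finset.sum_congr rfl h5, add_sub_cancel_left, pow_zero, one_smul]
    rfl
  exact LinearMap.congr_fun this t

lemma sub_mem_dX (t : R[X] ⊗[R] M) : t - 1 ⊗ₜ[R] (eX M t) ∈ LinearMap.range (dX (R := R) M) := by
  induction t with
  | zero => simp
  | add a b ha hb =>
    rw [map_add, tmul_add, add_sub_add_comm]
    exact add_mem ha hb
  | tmul p m =>
    rw [eX_tmul]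
    induction p using Polynomial.induction_on generalizing m with
    | C a =>
      have : (Polynomial.C a : R[X]) = a • 1 := by simp [Algebra.smul_def]
      rw [this, ← TensorProduct.smul_tmul', ← TensorProduct.tmul_smul]
      simp
    | add p q hp hq =>
      rw [TensorProduct.add_tmul, add_smul, tmul_add, add_sub_add_comm]
      exact add_mem (hp m) (hq m)
    | monomial k a h =>
      have h1 := h ((Polynomial.X : R[X]) • m)
      have h2 : dX M ((Polynomial.C a * Polynomial.X ^ k) ⊗ₜ m) ∈ LinearMap.range (dX (R := R) M) :=
        ⟨_, rfl⟩
      have h3 := add_mem h2 h1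
      rw [dX_tmul, ← mul_smul] at h3
      convert h3 using 1
      rw [pow_succ]
      ring_nf
      abel

lemma pd_poly (n : ℕ) (h : HasProjectiveDimensionLT (ModuleCat.of R M) (n+1)) :
    HasProjectiveDimensionLT (ModuleCat.of R[X] M) (n+2) := by
  have hz : eX (R := R) M ∘ₗ dX M = 0 := by
    apply TensorProduct.AlgebraTensorModule.ext
    intro p m
    simp [dX_tmul, eX_tmul, mul_smul, smul_comm p (Polynomial.X : R[X])]
  have hS := ModuleCat.shortComplex_shortExact (ModuleCat.shortComplexOfCompEqZero
      (dX (R := R) M) (eX (R := R) M) hz) (by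
        intro t
        constructor
        · intro (ht : eX M t = 0)
          have := sub_mem_dX M t
          rwa [ht, tmul_zero, sub_zero] at this
        · rintro ⟨s, rfl⟩
          exact LinearMap.congr_fun hz s) 
        (Function.LeftInverse.injective (hX_dX M)) 
        (fun m => ⟨1 ⊗ₜ m, by exact (eX_tmul M _ _).trans (one_smul _ _)⟩)
  have h1 := pd_baseChange (A := R[X]) n M h
  exact hS.hasProjectiveDimensionLT_X₃ (n+1) h1 (hasProjectiveDimensionLT_of_ge _ (n+1) _ (by omega))

end poly

open Polynomial in
lemma gl_poly {R : Type} [CommRing R] (n : ℕ)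
    (hg : ∀ M : ModuleCat.{0} R, HasProjectiveDimensionLT M (n+1)) (M : ModuleCat.{0} R[X]) :
    HasProjectiveDimensionLT M (n+2) := by
  let _ : Module R M := Module.compHom M (Polynomial.C : R →+* R[X])
  have : IsScalarTower R R[X] M := ⟨fun r p m => by
    rw [← Polynomial.C_mul', mul_smul]; rfl⟩
  exact pd_poly (R := R) M n (hg _)

attribute [local instance] RingHomInvPair.of_ringEquiv in
lemma gl_equiv {R R' : Type} [CommRing R] [CommRing R'] (e : R ≃+* R') (n : ℕ)
    (hg : ∀ M : ModuleCat.{0} R, HasProjectiveDimensionLT M (n+1)) (M : ModuleCat.{0} R') :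
    HasProjectiveDimensionLT M (n+1) := by
  let _ : Module R M := Module.compHom M (e : R →+* R')
  have : HasProjectiveDimensionLE (ModuleCat.of R M) n := hg _
  refine ModuleCat.hasProjectiveDimensionLE_of_semiLinearEquiv (M := ModuleCat.of R M) e ?_ n
  exact
    { toFun := fun m => m
      invFun := fun m => m
      map_add' := fun _ _ => rfl
      map_smul' := fun _ _ => rfl
      left_inv := fun _ => rfl
      right_inv := fun _ => rfl }

lemma gl_mv (K : Type) [Field K] (n : ℕ) (M : ModuleCat.{0} (MvPolynomial (Fin n) K)) :
    HasProjectiveDimensionLT M (n+1) := by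
  induction n with
  | zero =>
    refine gl_equiv (MvPolynomial.isEmptyRingEquiv K (Fin 0)).symm 0 ?_ M
    intro N
    rw [zero_add, ← projective_iff_hasProjectiveDimensionLT_one,
      ← IsProjective.iff_projective]
    have : Module.Free K N := Module.Free.of_divisionRing K N
    exact Module.Projective.of_free
  | succ n ih =>
    refine gl_equiv (MvPolynomial.finSuccEquiv K n).symm.toRingEquiv (n+1) ?_ M
    exact gl_poly n ih

lemma pd_equiv {R : Type} [CommRing R] {n : ℕ}
    {M N : Type} [AddCommGroup M] [Module R M] [AddCommGroup N] [Module R N]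
    (e : M ≃ₗ[R] N)
    (h : HasProjectiveDimensionLT (ModuleCat.of R M) n) :
    HasProjectiveDimensionLT (ModuleCat.of R N) n :=
  hasProjectiveDimensionLT_of_iso e.toModuleIso n

lemma pd_inf {R : Type} [CommRing R] {n : ℕ}
    (hg : ∀ M : ModuleCat.{0} R, HasProjectiveDimensionLT M (n+1)) (A B : Ideal R)
    (hA : HasProjectiveDimensionLT (ModuleCat.of R (R ⧸ A)) n)
    (hB : HasProjectiveDimensionLT (ModuleCat.of R (R ⧸ B)) n) :
    HasProjectiveDimensionLT (ModuleCat.of R (R ⧸ (A ⊓ B))) n := by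
  have h : HasProjectiveDimensionLT (ModuleCat.of R ((R ⧸ A) × (R ⧸ B))) n :=
    hasProjectiveDimensionLT_of_iso (ModuleCat.biprodIsoProd (ModuleCat.of R (R ⧸ A))
      (ModuleCat.of R (R ⧸ B))) n
  refine pd_of_injective hg (Submodule.liftQ (A ⊓ B)
    (LinearMap.prod (Submodule.mkQ A) (Submodule.mkQ B)) ?_) ?_ h
  · rw [LinearMap.ker_prod, Submodule.ker_mkQ, Submodule.ker_mkQ]
  · rw [← LinearMap.ker_eq_bot]
    apply Submodule.ker_liftQ_eq_bot
    rw [LinearMap.ker_prod, Submodule.ker_mkQ, Submodule.ker_mkQ]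

lemma pd_iInf {R : Type} [CommRing R] {n : ℕ} {ι : Type}
    (hg : ∀ M : ModuleCat.{0} R, HasProjectiveDimensionLT M (n+1)) (J : ι → Ideal R)
    (hJ : ∀ i, HasProjectiveDimensionLT (ModuleCat.of R (R ⧸ J i)) n) (s : Finset ι) :
    HasProjectiveDimensionLT (ModuleCat.of R (R ⧸ (s.inf J))) n := by
  classical
  induction s using Finset.induction_on with
  | empty =>
    have : HasProjectiveDimensionLT (ModuleCat.of R (R ⧸ ((∅ : Finset ι).inf J))) 0 := by
      rw [hasProjectiveDimensionLT_zero_iff_isZero, ModuleCat.isZero_iff_subsingleton]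
      change Subsingleton (R ⧸ (⊤ : Ideal R))
      infer_instance
    exact hasProjectiveDimensionLT_of_ge _ 0 n (by omega)
  | insert a s ha ih =>
    rw [Finset.inf_insert]
    exact pd_inf hg _ _ (hJ a) ih

lemma pd_ext_ideal (K : Type) [Field K] (m : ℕ) (i : Fin (m+1))
    (J : Ideal (MvPolynomial (Fin m) K)) :
    HasProjectiveDimensionLT (ModuleCat.of (MvPolynomial (Fin (m+1)) K)
      (MvPolynomial (Fin (m+1)) K ⧸
        J.map (rename i.succAbove : MvPolynomial (Fin m) K →ₐ[K] MvPolynomial (Fin (m+1)) K))) (m+1) := by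
  let τ : MvPolynomial (Fin m) K →ₐ[K] MvPolynomial (Fin (m+1)) K := rename i.succAbove
  let _ : Algebra (MvPolynomial (Fin m) K) (MvPolynomial (Fin (m+1)) K) := τ.toRingHom.toAlgebra
  let e0 : MvPolynomial (Fin (m+1)) K ≃ₐ[K] Polynomial (MvPolynomial (Fin m) K) :=
    (renameEquiv K i.cycleRange).trans (finSuccEquiv K m)
  have h0 : ∀ r, e0 (τ r) = Polynomial.C r := by
    intro r
    have : e0.toAlgHom.comp τ = Polynomial.CAlgHom := by
      apply MvPolynomial.algHom_ext
      intro j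
      simp [e0, τ, finSuccEquiv_X_succ]
    exact congrArg (fun f => f r) this
  let e1 : MvPolynomial (Fin (m+1)) K ≃ₗ[MvPolynomial (Fin m) K]
      Polynomial (MvPolynomial (Fin m) K) :=
    { e0 with
      map_smul' := fun r s => by
        change e0 (τ r * s) = r • e0 s
        rw [map_mul, h0, Polynomial.C_mul'] }
  have : Module.Flat (MvPolynomial (Fin m) K) (MvPolynomial (Fin (m+1)) K) :=
    Module.Flat.of_linearEquiv e1
  have h := pd_baseChange (A := MvPolynomial (Fin (m+1)) K) m (MvPolynomial (Fin m) K ⧸ J)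
    (gl_mv K m _)
  exact pd_equiv (Ideal.qoutMapEquivTensorQout (MvPolynomial (Fin (m+1)) K) (I := J)).symm h

lemma pd_dropped (K : Type) [Field K] (m : ℕ) (i : Fin (m+1)) (G : Set (Fin (m+1) →₀ ℕ)) :
    HasProjectiveDimensionLT (ModuleCat.of (MvPolynomial (Fin (m+1)) K)
      (MvPolynomial (Fin (m+1)) K ⧸ Ideal.span
        ((fun d => (monomial d (1 : K) : MvPolynomial (Fin (m+1)) K)) '' 
          ((fun g => g.erase i) '' G)))) (m+1) := by
  have h := pd_ext_ideal K m i (Ideal.span ((fun d => (monomial d (1 : K))) '' 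
    ((fun g => g.comapDomain i.succAbove (i.succAbove_right_injective.injOn)) '' G)))
  rw [Ideal.map_span] at h
  have hEq : (fun d => (monomial d (1 : K) : MvPolynomial (Fin (m+1)) K)) '' 
      ((fun g => g.erase i) '' G) =
      (rename i.succAbove : MvPolynomial (Fin m) K →ₐ[K] MvPolynomial (Fin (m+1)) K) ''
      ((fun d => (monomial d (1 : K))) '' 
    ((fun g => g.comapDomain i.succAbove (i.succAbove_right_injective.injOn)) '' G)) := by
   simp only [Set.image_image]
   apply Set.image_congr
   intro g _
   rw [rename_monomial]
   congr 2
   ext j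
   by_cases hj : j = i
   · subst hj
     rw [Finsupp.erase_same, Finsupp.mapDomain_of_notMem_range]
     simp
   · obtain ⟨k, rfl⟩ := Fin.exists_succAbove_eq hj
     rw [Finsupp.mapDomain_apply i.succAbove_right_injective, Finsupp.erase_ne hj]
     simp
  rw [hEq]
  exact h

/-- lower bound -/
lemma ext_ne (K : Type) [Field K] {n : ℕ} (s : Finset (Fin n)) :
    ¬ Subsingleton (Abelian.Ext.{0}
      (ModuleCat.of (MvPolynomial (Fin n) K) (MvPolynomial (Fin n) K ⧸
        Ideal.span (MvPolynomial.X '' (s : Set (Fin n)) : Set (MvPolynomial (Fin n) K))))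
      (ModuleCat.of (MvPolynomial (Fin n) K) (MvPolynomial (Fin n) K ⧸
        Ideal.span (MvPolynomial.X '' (Set.univ : Set (Fin n)) : Set (MvPolynomial (Fin n) K))))
      s.card) := by
  classical
  induction s using Finset.induction_on with
  | empty =>
    intro h
    rw [Finset.card_empty] at h
    have h2 := Abelian.Ext.homEquiv₀.subsingleton_congr.mp h
    have hle : Ideal.span (MvPolynomial.X '' ((∅ : Finset (Fin n)) : Set (Fin n)) : Set (MvPolynomial (Fin n) K))
      ≤ Ideal.span (MvPolynomial.X '' (Set.univ : Set (Fin n)) : Set (MvPolynomial (Fin n) K)) :=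
      Ideal.span_mono (Set.image_mono (Set.subset_univ _))
    have h3 := h2.elim (ModuleCat.ofHom (Submodule.factor hle)) 0
    have h4 : Submodule.factor hle (Submodule.Quotient.mk 1) = 0 := by
      have := congrArg (fun f => f.hom (Submodule.Quotient.mk 1)) h3
      exact this
    rw [← Submodule.mkQ_apply, Submodule.factor_mk, Submodule.mkQ_apply, Submodule.Quotient.mk_eq_zero,
      mem_ideal_span_X_image] at h4
    obtain ⟨i, -, h⟩ := h4 0 (by simp)
    simp at h
  | insert a s ha ih =>
    contrapose! ih
    rw [Finset.card_insert_of_notMem ha] at ih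
    set P := Ideal.span (MvPolynomial.X '' (s : Set (Fin n)) : Set (MvPolynomial (Fin n) K)) with hP
    set Q := Ideal.span (MvPolynomial.X '' ((insert a s : Finset (Fin n)) : Set (Fin n)) : Set (MvPolynomial (Fin n) K)) with hQ
    set U := Ideal.span (MvPolynomial.X '' (Set.univ : Set (Fin n)) : Set (MvPolynomial (Fin n) K)) with hU
    have hPQ : Q = P ⊔ Ideal.span {MvPolynomial.X a} := by
      rw [hQ, hP, Finset.coe_insert, Set.image_insert_eq, Set.insert_eq, Ideal.span_union, sup_comm]
    have hle : P ≤ Q := hPQ ▸ le_sup_left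
    let f : (MvPolynomial (Fin n) K ⧸ P) →ₗ[MvPolynomial (Fin n) K] (MvPolynomial (Fin n) K ⧸ P) :=
      LinearMap.lsmul _ _ (MvPolynomial.X a : MvPolynomial (Fin n) K)
    let g : (MvPolynomial (Fin n) K ⧸ P) →ₗ[MvPolynomial (Fin n) K] (MvPolynomial (Fin n) K ⧸ Q) :=
      Submodule.factor hle
    have hf : ∀ p : MvPolynomial (Fin n) K, f (Submodule.Quotient.mk p) = 
      Submodule.Quotient.mk (MvPolynomial.X a * p) := fun p => rfl
    have hg : ∀ p : MvPolynomial (Fin n) K, g (Submodule.Quotient.mk p) = 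
      Submodule.Quotient.mk p := fun p => rfl
    have hex : Function.Exact f g := by
      intro y
      obtain ⟨p, rfl⟩ := Submodule.Quotient.mk_surjective _ y
      rw [hg, Submodule.Quotient.mk_eq_zero]
      constructor
      · intro hp
        rw [hPQ, Submodule.mem_sup] at hp
        obtain ⟨u, hu, v, hv, rfl⟩ := hp
        obtain ⟨w, rfl⟩ := Ideal.mem_span_singleton.1 hv
        refine ⟨Submodule.Quotient.mk w, ?_⟩
        rw [hf, Submodule.Quotient.eq]
        simpa using hu
      · rintro ⟨x, hx⟩
        obtain ⟨q, rfl⟩ := Submodule.Quotient.mk_surjective _ x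
        rw [hf, Submodule.Quotient.eq] at hx
        have h1 : MvPolynomial.X a * q ∈ Q := by
          rw [hPQ]
          exact Ideal.mem_sup_right (Ideal.mul_mem_right _ _ (Ideal.mem_span_singleton_self _))
        have := Q.sub_mem h1 (hle hx)
        simpa using this
    have hinj : Function.Injective f := by
      rw [← LinearMap.ker_eq_bot, LinearMap.ker_eq_bot']
      intro y hy
      obtain ⟨p, rfl⟩ := Submodule.Quotient.mk_surjective _ y
      rw [hf, Submodule.Quotient.mk_eq_zero, hP, mem_ideal_span_X_image] at hy
      rw [Submodule.Quotient.mk_eq_zero, hP, mem_ideal_span_X_image]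
      intro u hu
      obtain ⟨i, hi, h⟩ := hy (Finsupp.single a 1 + u) (by
        rw [mem_support_iff, MvPolynomial.coeff_X_mul]
        exact mem_support_iff.1 hu)
      refine ⟨i, hi, ?_⟩
      have : a ≠ i := by rintro rfl; exact ha hi
      simpa [Finsupp.single_apply, this] using h
    have hsur : Function.Surjective g := Submodule.factor_surjective hle
    have hS := ModuleCat.shortComplex_shortExact (ModuleCat.shortComplexOfCompEqZero
      f g hex.linearMap_comp_eq_zero) hex hinj hsur
    refine subsingleton_of_forall_eq 0 fun x => ?_
    obtain ⟨y, rfl⟩ := Abelian.Ext.contravariant_sequence_exact₁ hS _ x (add_comm _ _) (ih.elim _ _)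
    have hfeq : (ModuleCat.shortComplexOfCompEqZero f g hex.linearMap_comp_eq_zero).f =
      (MvPolynomial.X a : MvPolynomial (Fin n) K) • 𝟙 _ := rfl
    have hzero : (MvPolynomial.X a : MvPolynomial (Fin n) K) • 𝟙 (ModuleCat.of (MvPolynomial (Fin n) K) (MvPolynomial (Fin n) K ⧸ U)) = 0 := by
      ext
      change Submodule.Quotient.mk (MvPolynomial.X a * (1 : MvPolynomial (Fin n) K)) = 0
      rw [Submodule.Quotient.mk_eq_zero]
      exact Ideal.mul_mem_right _ _ (Ideal.subset_span ⟨a, trivial, rfl⟩)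
    rw [hfeq, Abelian.Ext.mk₀_smul, Abelian.Ext.smul_comp, Abelian.Ext.mk₀_id_comp]
    rw [← Abelian.Ext.comp_mk₀_id y, ← Abelian.Ext.comp_smul, ← Abelian.Ext.mk₀_smul, hzero]
    simp

def IsSocle {n : ℕ} (G : Finset (Fin n →₀ ℕ)) (b : Fin n →₀ ℕ) : Prop :=
  (∀ g ∈ G, ¬ g ≤ b) ∧ ∀ i, ∃ g ∈ G, g ≤ b + Finsupp.single i 1

lemma dom_of_socle {n : ℕ} (G : Finset (Fin n →₀ ℕ)) (b : Fin n →₀ ℕ) (h : IsSocle G b) :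
    ∃ L ⊆ G, L.card = n ∧
      (∀ v ∈ L, ∃ i : Fin n, ∀ w ∈ L, w ≠ v → w i < v i) ∧
      ∀ g ∈ G, ¬ (∀ a : Fin n, g a ≠ 0 → g a < L.sup (fun h => h a)) := by
  classical
  obtain ⟨h1, h2⟩ := h
  choose g hgG hg using h2
  have hne : ∀ i j, j ≠ i → g i j ≤ b j := by
    intro i j hj
    have := hg i j
    simpa [Finsupp.single_apply, hj.symm] using this
  have hii : ∀ i, g i i = b i + 1 := by
    intro i
    have h3 := hg i i
    simp only [Finsupp.add_apply, Finsupp.single_eq_same] at h3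
    by_contra hlt
    apply h1 _ (hgG i)
    intro j
    by_cases hj : j = i
    · subst hj; omega
    · exact hne i j hj
  have hinj : Function.Injective g := by
    intro i j hij
    by_contra hne'
    have := hne j i hne'
    rw [← hij, hii] at this
    omega
  refine ⟨Finset.univ.image g, ?_, ?_, ?_, ?_⟩
  · intro x hx
    obtain ⟨i, -, rfl⟩ := Finset.mem_image.1 hx
    exact hgG i
  · rw [Finset.card_image_of_injective _ hinj]; simp
  · intro v hv
    obtain ⟨i, -, rfl⟩ := Finset.mem_image.1 hv
    refine ⟨i, fun w hw hwi => ?_⟩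
    obtain ⟨j, -, rfl⟩ := Finset.mem_image.1 hw
    have : i ≠ j := by rintro rfl; exact hwi rfl
    have := hne j i this
    rw [hii]; omega
  · intro v hv hs
    apply h1 v hv
    intro a
    by_cases h0 : v a = 0
    · omega
    · have h3 := hs a h0
      have : (Finset.univ.image g).sup (fun h => h a) ≤ b a + 1 := by
        apply Finset.sup_le
        intro w hw
        obtain ⟨j, -, rfl⟩ := Finset.mem_image.1 hw
        by_cases hj : a = j
        · subst hj; exact (hii a).le
        · exact (hne j a hj).trans (Nat.le_succ _)
      omega

lemma socle_of_dom {n : ℕ} (G L : Finset (Fin n →₀ ℕ)) (hLG : L ⊆ G) (hc : L.card = n)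
    (hdom : ∀ v ∈ L, ∃ i : Fin n, ∀ w ∈ L, w ≠ v → w i < v i)
    (hs : ∀ g ∈ G, ¬ (∀ a : Fin n, g a ≠ 0 → g a < L.sup (fun h => h a))) :
    ∃ b, IsSocle G b := by
  classical
  choose i hi using fun v : L => hdom v v.2
  have hinj : Function.Injective i := by
    intro v w hvw
    by_contra hne
    have h1 := hi v w w.2 (fun h => hne (Subtype.ext h.symm))
    have h2 := hi w v v.2 (fun h => hne (Subtype.ext h))
    rw [hvw] at h1
    omega
  have hbij : Function.Bijective i := by
    rw [Fintype.bijective_iff_injective_and_card]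
    exact ⟨hinj, by simp [hc]⟩
  have hpos : ∀ a, 0 < L.sup (fun h => h a) := by
    intro a
    by_contra h0
    obtain ⟨v, rfl⟩ := hbij.2 a
    have hle : ∀ w ∈ L, w (i v) ≤ L.sup (fun h => h (i v)) := fun w hw =>
      Finset.le_sup (f := fun h : Fin n →₀ ℕ => h (i v)) hw
    have hall : ∀ w ∈ L, w = v := by
      intro w hw
      by_contra hne
      have := hi v w hw hne
      have := hle v v.2
      omega
    have hL : L = {v.1} := by
      ext w
      rw [Finset.mem_singleton]
      exact ⟨hall w, fun h => h ▸ v.2⟩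
    have hn : n = 1 := by rw [← hc, hL]; simp
    subst hn
    apply hs v (hLG v.2)
    intro a ha
    have : a = i v := Subsingleton.elim _ _
    subst this
    have := hle v v.2
    omega
  refine ⟨Finsupp.equivFunOnFinite.symm (fun a => L.sup (fun h => h a) - 1), ?_, ?_⟩
  · intro g hg hle
    apply hs g hg
    intro a _
    have h1 := hle a
    have h2 := hpos a
    simp only [Finsupp.equivFunOnFinite_symm_apply_apply] at h1
    omega
  · intro a
    obtain ⟨v, rfl⟩ := hbij.2 a
    refine ⟨v, hLG v.2, ?_⟩
    intro c
    have h1 : v.1 c ≤ L.sup (fun h => h c) :=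
      Finset.le_sup (f := fun h : Fin n →₀ ℕ => h c) v.2
    have h2 := hpos c
    simp only [Finsupp.add_apply, Finsupp.equivFunOnFinite_symm_apply_apply]
    by_cases hc' : i v = c
    · rw [hc', Finsupp.single_eq_same]; omega
    · obtain ⟨w, rfl⟩ := hbij.2 c
      have hwv : v.1 ≠ w.1 := fun h => hc' (by rw [Subtype.ext h])
      have h3 := hi w v v.2 hwv
      have h4 : w.1 (i w) ≤ L.sup (fun h => h (i w)) :=
        Finset.le_sup (f := fun h : Fin n →₀ ℕ => h (i w)) w.2
      omega

lemma exists_socle {n : ℕ} (G : Finset (Fin n →₀ ℕ)) (u : Fin n →₀ ℕ)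
    (hu : ∀ g ∈ G, ¬ g ≤ u) (h : ∀ i, ∃ g ∈ G, g.erase i ≤ u) :
    ∃ b, IsSocle G b := by
  classical
  choose g hgG hg using h
  let N : Fin n →₀ ℕ := Finsupp.equivFunOnFinite.symm (fun i => g i i)
  let T : Set (Fin n →₀ ℕ) := {c | u ≤ c ∧ ∀ g ∈ G, ¬ g ≤ c}
  have hT : T.Finite := by
    apply (Set.finite_Iic N).subset
    rintro c ⟨hc1, hc2⟩ i
    by_contra hlt
    simp only [N, Finsupp.equivFunOnFinite_symm_apply_apply] at hlt
    apply hc2 _ (hgG i)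
    intro j
    by_cases hj : j = i
    · subst hj; omega
    · have h1 := hg i j
      rw [Finsupp.erase_ne hj] at h1
      exact h1.trans (hc1 j)
  obtain ⟨b, hb⟩ := hT.exists_maximal ⟨u, le_rfl, hu⟩
  refine ⟨b, hb.1.2, fun i => ?_⟩
  by_contra! hcon
  have h1 : b + Finsupp.single i 1 ∈ T := ⟨hb.1.1.trans (self_le_add_right _ _), hcon⟩
  have h2 := hb.2 h1 (self_le_add_right _ _) i
  simp at h2

lemma not_LT_of_socle (K : Type) [Field K] {n : ℕ} (G : Finset (Fin n →₀ ℕ)) (b : Fin n →₀ ℕ)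
    (hb : IsSocle G b) :
    ¬ HasProjectiveDimensionLT (ModuleCat.of (MvPolynomial (Fin n) K) (MvPolynomial (Fin n) K ⧸
      Ideal.span ((fun d => (monomial d (1 : K) : MvPolynomial (Fin n) K)) '' ↑G))) n := by
  intro h
  set I := Ideal.span ((fun d => (monomial d (1 : K) : MvPolynomial (Fin n) K)) '' (G : Set (Fin n →₀ ℕ))) with hI
  let f : MvPolynomial (Fin n) K →ₗ[MvPolynomial (Fin n) K] (MvPolynomial (Fin n) K ⧸ I) :=
    (Submodule.mkQ I) ∘ₗ (LinearMap.lsmul _ _ (monomial b (1 : K)))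
  have hker : LinearMap.ker f =
      Ideal.span (MvPolynomial.X '' (Set.univ : Set (Fin n)) : Set (MvPolynomial (Fin n) K)) := by
    apply le_antisymm
    · intro p hp
      have hp' : monomial b (1 : K) * p ∈ I := by
        rw [← Submodule.Quotient.mk_eq_zero]; exact hp
      rw [hI, mem_ideal_span_monomial_image] at hp'
      rw [mem_ideal_span_X_image]
      intro u hu
      by_contra! hcon
      have hu0 : u = 0 := by ext i; exact hcon i trivial
      subst hu0
      obtain ⟨g, hg, hle⟩ := hp' b (by
        rw [mem_support_iff] at hu ⊢
        have := coeff_monomial_mul (0 : Fin n →₀ ℕ) b (1 : K) p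
        rw [add_zero] at this
        rw [this]; simpa using hu)
      exact hb.1 g hg hle
    · rw [Ideal.span_le]
      rintro _ ⟨i, -, rfl⟩
      obtain ⟨g, hg, hle⟩ := hb.2 i
      change Submodule.Quotient.mk (monomial b (1 : K) * X i) = 0
      rw [Submodule.Quotient.mk_eq_zero, hI, mem_ideal_span_monomial_image]
      intro u hu
      refine ⟨g, hg, ?_⟩
      rw [X, monomial_mul, mul_one] at hu
      have := support_monomial_subset hu
      rw [Finset.mem_singleton] at this
      exact this ▸ hle
  have h2 := pd_of_injective (gl_mv K n) (Submodule.liftQ _ f hker.ge)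
    (LinearMap.ker_eq_bot.1 (Submodule.ker_liftQ_eq_bot _ _ _ hker.le)) h
  have h3 := ext_ne K (Finset.univ : Finset (Fin n))
  rw [Finset.card_univ, Fintype.card_fin, Finset.coe_univ] at h3
  exact h3 (HasProjectiveDimensionLT.subsingleton _ n n le_rfl _)

lemma LT_of_no_socle (K : Type) [Field K] {n : ℕ} (hn : 0 < n) (G : Finset (Fin n →₀ ℕ))
    (hb : ¬ ∃ b, IsSocle G b) :
    HasProjectiveDimensionLT (ModuleCat.of (MvPolynomial (Fin n) K) (MvPolynomial (Fin n) K ⧸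
      Ideal.span ((fun d => (monomial d (1 : K) : MvPolynomial (Fin n) K)) '' ↑G))) n := by
  obtain ⟨m, rfl⟩ : ∃ m, n = m + 1 := ⟨n - 1, by omega⟩
  have h := pd_iInf (gl_mv K (m+1)) _ (fun i => pd_dropped K m i (G : Set (Fin (m+1) →₀ ℕ)))
    Finset.univ
  have hEq : Ideal.span ((fun d => (monomial d (1 : K) : MvPolynomial (Fin (m+1)) K)) '' ↑G) =
      Finset.univ.inf (fun i : Fin (m+1) => Ideal.span
        ((fun d => (monomial d (1 : K) : MvPolynomial (Fin (m+1)) K)) ''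
          ((fun g => g.erase i) '' (G : Set (Fin (m+1) →₀ ℕ))))) := by
    apply le_antisymm
    · apply Finset.le_inf
      intro i _ p hp
      rw [mem_ideal_span_monomial_image] at hp ⊢
      intro u hu
      obtain ⟨g, hg, hle⟩ := hp u hu
      refine ⟨_, ⟨g, hg, rfl⟩, le_trans ?_ hle⟩
      intro j
      by_cases hj : j = i
      · subst hj; simp
      · simp [Finsupp.erase_ne hj]
    · intro p hp
      rw [Submodule.mem_finsetInf] at hp
      rw [mem_ideal_span_monomial_image]
      intro u hu
      by_contra! hcon
      apply hb
      refine exists_socle G u hcon fun i => ?_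
      have h1 := hp i (Finset.mem_univ _)
      rw [mem_ideal_span_monomial_image] at h1
      obtain ⟨_, ⟨g, hg, rfl⟩, hle⟩ := h1 u hu
      exact ⟨g, hg, hle⟩
  rw [hEq]
  exact h

/-- Let `I ⊆ S = K[x_1,…,x_n]` be the monomial ideal with minimal monomial generating set
`G` (an antichain of exponent vectors).  Then `projdim (S/I) = n` iff `G` contains a
dominant subset `L` of cardinality `n` such that no element of `G` strongly divides
`lcm L`. -/
theorem projDim_eq_n_iff {n : ℕ} (hn : 0 < n) (K : Type) [Field K]
    (G : Finset (Fin n →₀ ℕ))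
    (hmin : ∀ u ∈ G, ∀ v ∈ G, u ≤ v → u = v)
    (I : Ideal (MvPolynomial (Fin n) K))
    (hI : I = Ideal.span ((fun d => (monomial d (1 : K) : MvPolynomial (Fin n) K)) '' ↑G)) :
    projDim (MvPolynomial (Fin n) K)
      (ModuleCat.of (MvPolynomial (Fin n) K) (MvPolynomial (Fin n) K ⧸ I)) = (n : ℕ∞) ↔
    ∃ L ⊆ G, L.card = n ∧
      (∀ v ∈ L, ∃ i : Fin n, ∀ w ∈ L, w ≠ v → w i < v i) ∧
      ∀ g ∈ G, ¬ (∀ a : Fin n, g a ≠ 0 → g a < L.sup (fun h => h a)) := by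
  subst hI
  rw [projDim_eq_iff _ _ n hn (gl_mv K n _)]
  constructor
  · intro h
    by_contra hcon
    apply h
    apply LT_of_no_socle K hn G
    rintro ⟨b, hb⟩
    exact hcon (dom_of_socle G b hb)
  · rintro ⟨L, hLG, hc, hdom, hs⟩
    obtain ⟨b, hb⟩ := socle_of_dom G L hLG hc hdom hs
    exact not_LT_of_socle K G b hb
end

section
/- Let I = (ab, ac, bd, cd) in S = K[a,b,c,d]. Then proj dim(S/I) = 3, but the maximum cardinality of a dominant subset of G(I) is 2. -/
open CategoryTheory

def DominantSet {n : ℕ} (L : Finset (Fin n → ℕ)) : Prop :=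
  ∀ v ∈ L, ∃ i : Fin n, ∀ w ∈ L, w ≠ v → w i < v i

open MvPolynomial


section Gen
open Limits
variable {R : Type} [CommRing R]

lemma key {X Y : ModuleCat.{0} R} (f g : X ⟶ Y) (h : f = g) :
    (Iso.refl X).hom ≫ f = g ≫ (Iso.refl Y).hom := by simp [h]

noncomputable def genRes (X : ℕ → ModuleCat.{0} R) (d : ∀ n, X (n+1) ⟶ X n)
    (hP : ∀ n, Projective (X n)) (sq : ∀ n, d (n+1) ≫ d n = 0)
    (ex : ∀ n, (ShortComplex.mk (d (n+1)) (d n) (sq n)).Exact)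
    (M : ModuleCat.{0} R) (π : X 0 ⟶ M) (hπ : d 0 ≫ π = 0)
    (ex0 : (ShortComplex.mk (d 0) π hπ).Exact) (hepi : Epi π) : ProjectiveResolution M where
  complex := ChainComplex.of X d sq
  projective := hP
  π := (ChainComplex.toSingle₀Equiv _ _).symm ⟨π, by
    have : (ChainComplex.of X d sq).d 1 0 = d 0 := ChainComplex.of_d X d 0
    rw [this]; exact hπ⟩
  quasiIso := ⟨fun n => by
    have hd : ∀ n, (ChainComplex.of X d sq).d (n+1) n = d n := fun n => ChainComplex.of_d X d n
    cases n
    · rw [ChainComplex.quasiIsoAt₀_iff, ShortComplex.quasiIso_iff_of_zeros']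
      · refine (ShortComplex.exact_and_epi_g_iff_of_iso ?_).2 ⟨ex0, hepi⟩
        exact ShortComplex.isoMk (Iso.refl _) (Iso.refl _) (Iso.refl _)
          (key _ _ (hd 0).symm)
          (key _ _ (ChainComplex.toSingle₀Equiv_symm_apply_f_zero (C := ChainComplex.of X d sq) (X := M) π
            (by rw [hd 0]; exact hπ)).symm)
      all_goals rfl
    · rename_i n
      rw [quasiIsoAt_iff_exactAt']
      · rw [HomologicalComplex.exactAt_iff' _ (n + 1 + 1) (n + 1) n (by simp) (by simp)]
        refine (ShortComplex.exact_iff_of_iso ?_).2 (ex n)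
        exact ShortComplex.isoMk (Iso.refl _) (Iso.refl _) (Iso.refl _)
          (key _ _ (hd _).symm) (key _ _ (hd _).symm)
      · apply ChainComplex.exactAt_succ_single_obj⟩

lemma ext_iff (X : ℕ → ModuleCat.{0} R) (d : ∀ n, X (n+1) ⟶ X n)
    (hP : ∀ n, Projective (X n)) (sq : ∀ n, d (n+1) ≫ d n = 0)
    (ex : ∀ n, (ShortComplex.mk (d (n+1)) (d n) (sq n)).Exact)
    (M : ModuleCat.{0} R) (π : X 0 ⟶ M) (hπ : d 0 ≫ π = 0)
    (ex0 : (ShortComplex.mk (d 0) π hπ).Exact) (hepi : Epi π) (n : ℕ) (N : ModuleCat.{0} R) :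
    Subsingleton (((Ext R (ModuleCat R) (n + 1)).obj (Opposite.op M)).obj N) ↔
     ∀ φ : X (n+1) ⟶ N, d (n+1) ≫ φ = 0 → ∃ ψ : X n ⟶ N, d n ≫ ψ = φ := by
  have hd : ∀ n, (ChainComplex.of X d sq).d (n+1) n = d n := fun n => ChainComplex.of_d X d n
  let P := genRes X d hP sq ex M π hπ ex0 hepi
  have e := P.isoExt (R := R) (n+1) N
  rw [← ModuleCat.isZero_iff_subsingleton, e.isZero_iff,
    ← HomologicalComplex.exactAt_iff_isZero_homology,
    HomologicalComplex.exactAt_iff' _ n (n + 1) (n+2) (by simp) (by simp),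
    ShortComplex.moduleCat_exact_iff]
  change (∀ φ : X (n+1) ⟶ N, (ChainComplex.of X d sq).d (n+2) (n+1) ≫ φ = 0 →
    ∃ ψ : X n ⟶ N, (ChainComplex.of X d sq).d (n+1) n ≫ ψ = φ) ↔ _
  rw [hd, hd]
end Gen

section Alg
variable {K : Type} [Field K]

lemma kosz {i j : Fin 4} (hij : i ≠ j) {f g : MvPolynomial (Fin 4) K}
    (h : X i * f = X j * g) : ∃ u, f = X j * u ∧ g = X i * u := by
  have hd : (X j : MvPolynomial (Fin 4) K) ∣ X i * f := ⟨g, h⟩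
  rcases (X_prime (R := K) (i := j)).dvd_or_dvd hd with h1 | ⟨u, rfl⟩
  · rw [X_dvd_X] at h1
    exact absurd h1.symm hij
  · refine ⟨u, rfl, ?_⟩
    apply mul_left_cancel₀ (X_ne_zero (R := K) j)
    rw [← h]; ring

lemma prim {u p q : MvPolynomial (Fin 4) K} (h : X 3 * u = X 1 * p + X 2 * q) :
    ∃ p' q', u = X 1 * p' + X 2 * q' := by
  have hs : (MvPolynomial.X '' ({1, 2} : Set (Fin 4)) : Set (MvPolynomial (Fin 4) K)) = {X 1, X 2} := by
    simp [Set.image_pair]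
  have hm : X 3 * u ∈ Ideal.span (MvPolynomial.X '' ({1, 2} : Set (Fin 4)) : Set (MvPolynomial (Fin 4) K)) := by
    rw [hs, Ideal.mem_span_pair]
    exact ⟨p, q, by rw [h]; ring⟩
  have : u ∈ Ideal.span (MvPolynomial.X '' ({1, 2} : Set (Fin 4)) : Set (MvPolynomial (Fin 4) K)) := by
    rw [mem_ideal_span_X_image] at hm ⊢
    intro m hmu
    obtain ⟨i, hi, h2⟩ := hm (Finsupp.single 3 1 + m) (by
      rw [mem_support_iff] at hmu ⊢
      rwa [coeff_X_mul])
    refine ⟨i, hi, ?_⟩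
    rcases hi with rfl | rfl <;> simpa using h2
  rw [hs, Ideal.mem_span_pair] at this
  obtain ⟨p', q', h⟩ := this
  exact ⟨p', q', by rw [← h]; ring⟩

variable (K)
noncomputable def m1 : (Fin 4 → MvPolynomial (Fin 4) K) →ₗ[MvPolynomial (Fin 4) K] (Fin 1 → MvPolynomial (Fin 4) K) :=
  Matrix.mulVecLin !![X 0 * X 1, X 0 * X 2, X 1 * X 3, X 2 * X 3]
noncomputable def m2 : (Fin 4 → MvPolynomial (Fin 4) K) →ₗ[MvPolynomial (Fin 4) K] (Fin 4 → MvPolynomial (Fin 4) K) :=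
  Matrix.mulVecLin !![X 2, 0, X 3, 0; -X 1, 0, 0, X 3; 0, X 2, -X 0, 0; 0, -X 1, 0, -X 0]
noncomputable def m3 : (Fin 1 → MvPolynomial (Fin 4) K) →ₗ[MvPolynomial (Fin 4) K] (Fin 4 → MvPolynomial (Fin 4) K) :=
  Matrix.mulVecLin !![X 3; -X 0; -X 2; X 1]
variable {K}

lemma m1_apply (v : Fin 4 → MvPolynomial (Fin 4) K) : m1 K v =
   ![X 0 * X 1 * v 0 + X 0 * X 2 * v 1 + X 1 * X 3 * v 2 + X 2 * X 3 * v 3] := by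
  ext i : 1
  fin_cases i
  simp [m1, Matrix.mulVec, dotProduct, Fin.sum_univ_succ]; ring

lemma m2_apply (v : Fin 4 → MvPolynomial (Fin 4) K) : m2 K v =
   ![X 2 * v 0 + X 3 * v 2, - X 1 * v 0 + X 3 * v 3, X 2 * v 1 - X 0 * v 2, - X 1 * v 1 - X 0 * v 3] := by
  ext i : 1
  fin_cases i <;>
  simp [m2, Matrix.mulVec, dotProduct, Fin.sum_univ_succ] <;> ring

lemma m3_apply (v : Fin 1 → MvPolynomial (Fin 4) K) : m3 K v =
   ![X 3 * v 0, - X 0 * v 0, - X 2 * v 0, X 1 * v 0] := by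
  ext i : 1
  fin_cases i <;>
  simp [m3, Matrix.mulVec, dotProduct]

lemma m12 : m1 K ∘ₗ m2 K = 0 := by
  apply LinearMap.ext; intro v
  rw [LinearMap.comp_apply, m1_apply, m2_apply]
  ext i : 1
  fin_cases i
  simp; ring

lemma m23 : m2 K ∘ₗ m3 K = 0 := by
  apply LinearMap.ext; intro v
  rw [LinearMap.comp_apply, m2_apply, m3_apply]
  ext i : 1
  fin_cases i <;> simp <;> ring

lemma m3_inj (v) (h : m3 K v = 0) : v = 0 := by
  rw [m3_apply] at h
  have := congrFun h 0
  simp at this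
  ext i : 1
  fin_cases i
  exact this

lemma ex2 (v) (h : m2 K v = 0) : ∃ w, m3 K w = v := by
  rw [m2_apply] at h
  have h0 := congrFun h 0
  have h1 := congrFun h 1
  have h2 := congrFun h 2
  simp at h0 h1 h2
  obtain ⟨t, e0, e2⟩ := kosz (K := K) (i := 2) (j := 3) (f := v 0) (g := - v 2) (by decide)
    (by linear_combination h0)
  have e3 : v 3 = X 1 * t := by
    apply mul_left_cancel₀ (X_ne_zero (R := K) (3 : Fin 4))
    rw [e0] at h1
    linear_combination h1
  have e1 : v 1 = - X 0 * t := by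
    apply mul_left_cancel₀ (X_ne_zero (R := K) (2 : Fin 4))
    linear_combination h2 - X 0 * e2
  refine ⟨fun _ => t, ?_⟩
  rw [m3_apply]
  ext i : 1
  fin_cases i
  · simp [e0]
  · simp [e1]
  · simp; linear_combination e2
  · simp [e3]

lemma ex1 (v) (h : m1 K v = 0) : ∃ w, m2 K w = v := by
  rw [m1_apply] at h
  have h0 := congrFun h 0
  simp at h0
  obtain ⟨u, e0, e1⟩ := kosz (K := K) (i := 0) (j := 3) (f := X 1 * v 0 + X 2 * v 1)
    (g := - (X 1 * v 2 + X 2 * v 3)) (by decide) (by linear_combination h0)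
  obtain ⟨p, q, rfl⟩ := prim e0.symm
  obtain ⟨s, f0, f1⟩ := kosz (K := K) (i := 1) (j := 2) (f := v 0 - X 3 * p)
    (g := - (v 1 - X 3 * q)) (by decide) (by linear_combination e0)
  obtain ⟨s', f2, f3⟩ := kosz (K := K) (i := 1) (j := 2) (f := v 2 + X 0 * p)
    (g := - (v 3 + X 0 * q)) (by decide) (by linear_combination - e1)
  refine ⟨![s, s', p, q], ?_⟩
  rw [m2_apply]
  ext i : 1
  fin_cases i
  · simp; linear_combination - f0
  · simp; linear_combination f1
  · simp; linear_combination - f2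
  · simp; linear_combination f3

variable (K) in
noncomputable def aug (I : Ideal (MvPolynomial (Fin 4) K)) :
    (Fin 1 → MvPolynomial (Fin 4) K) →ₗ[MvPolynomial (Fin 4) K] MvPolynomial (Fin 4) K ⧸ I :=
  I.mkQ ∘ₗ LinearMap.proj 0

lemma mem_I (x : MvPolynomial (Fin 4) K) :
    x ∈ Ideal.span {X 0 * X 1, X 0 * X 2, X 1 * X 3, X 2 * X 3} ↔
    ∃ v : Fin 4 → MvPolynomial (Fin 4) K,
      X 0 * X 1 * v 0 + X 0 * X 2 * v 1 + X 1 * X 3 * v 2 + X 2 * X 3 * v 3 = x := by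
  simp only [Ideal.mem_span_insert, Ideal.mem_span_singleton']
  constructor
  · rintro ⟨a, _, ⟨b, _, ⟨c, _, ⟨d, rfl⟩, rfl⟩, rfl⟩, rfl⟩
    exact ⟨![a, b, c, d], by simp; ring⟩
  · rintro ⟨v, rfl⟩
    exact ⟨v 0, _, ⟨v 1, _, ⟨v 2, _, ⟨v 3, rfl⟩, rfl⟩, rfl⟩, by ring⟩

variable {I : Ideal (MvPolynomial (Fin 4) K)}
    (hI : I = Ideal.span {X 0 * X 1, X 0 * X 2, X 1 * X 3, X 2 * X 3})
lemma aug_surj : Function.Surjective (aug K I) := by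
  intro y
  obtain ⟨x, rfl⟩ := I.mkQ_surjective y
  exact ⟨fun _ => x, rfl⟩

lemma aug_iff (hI : I = Ideal.span {X 0 * X 1, X 0 * X 2, X 1 * X 3, X 2 * X 3}) (v) :
    aug K I v = 0 ↔ ∃ w, m1 K w = v := by
  have : aug K I v = 0 ↔ v 0 ∈ I := by
    simp [aug, Ideal.Quotient.eq_zero_iff_mem]
  rw [this, hI, mem_I]
  refine exists_congr fun w => ?_
  rw [m1_apply]
  constructor
  · intro h
    ext i : 1
    fin_cases i
    simpa using h
  · intro h
    simpa using congrFun h 0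

def rk : ℕ → ℕ
  | 0 => 1 | 1 => 4 | 2 => 4 | 3 => 1 | _ => 0

variable (K) in
noncomputable def dl : (n : ℕ) → (Fin (rk (n+1)) → MvPolynomial (Fin 4) K) →ₗ[MvPolynomial (Fin 4) K] (Fin (rk n) → MvPolynomial (Fin 4) K)
  | 0 => m1 K | 1 => m2 K | 2 => m3 K | _ + 3 => 0

lemma dl_sq (n : ℕ) : dl K n ∘ₗ dl K (n+1) = 0 := by
  match n with
  | 0 => exact m12
  | 1 => exact m23
  | 2 => exact LinearMap.comp_zero _
  | n+3 => exact LinearMap.comp_zero _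

lemma dl_ex (n : ℕ) (v) (h : dl K n v = 0) : ∃ w, dl K (n+1) w = v := by
  match n with
  | 0 => exact ex1 v h
  | 1 => exact ex2 v h
  | 2 => exact ⟨0, by rw [map_zero]; exact (m3_inj v h).symm⟩
  | n+3 => exact ⟨0, funext fun i => i.elim0⟩

lemma m1_min (v i) : constantCoeff (m1 K v i) = 0 := by
  rw [m1_apply]; fin_cases i; simp
lemma m2_min (v i) : constantCoeff (m2 K v i) = 0 := by
  rw [m2_apply]; fin_cases i <;> simp
lemma m3_min (v i) : constantCoeff (m3 K v i) = 0 := by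
  rw [m3_apply]; fin_cases i <;> simp

lemma dl_min (n : ℕ) (v i) : constantCoeff (dl K n v i) = 0 := by
  match n with
  | 0 => exact m1_min v i
  | 1 => exact m2_min v i
  | 2 => exact m3_min v i
  | n+3 => exact map_zero _

lemma phi_zero {r : ℕ} (φ : (Fin r → MvPolynomial (Fin 4) K) →ₗ[MvPolynomial (Fin 4) K]
    (MvPolynomial (Fin 4) K ⧸ RingHom.ker (constantCoeff (σ := Fin 4) (R := K))))
    (w) (hw : ∀ i, constantCoeff (w i) = 0) : φ w = 0 := by
  rw [LinearMap.pi_apply_eq_sum_univ φ w]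
  refine Finset.sum_eq_zero fun i _ => ?_
  obtain ⟨y, hy⟩ := Ideal.Quotient.mk_surjective (φ fun j => if i = j then 1 else 0)
  rw [← hy, ← Ideal.Quotient.mk_eq_mk, ← Submodule.Quotient.mk_smul, Submodule.Quotient.mk_eq_zero,
    RingHom.mem_ker, smul_eq_mul, map_mul, hw, zero_mul]

lemma ext_iff' (hI : I = Ideal.span {X 0 * X 1, X 0 * X 2, X 1 * X 3, X 2 * X 3})
    (n : ℕ) (N : ModuleCat.{0} (MvPolynomial (Fin 4) K)) :
    Subsingleton (((Ext (MvPolynomial (Fin 4) K) (ModuleCat (MvPolynomial (Fin 4) K)) (n + 1)).obj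
      (Opposite.op (ModuleCat.of (MvPolynomial (Fin 4) K) (MvPolynomial (Fin 4) K ⧸ I)))).obj N) ↔
     ∀ φ : (Fin (rk (n+1)) → MvPolynomial (Fin 4) K) →ₗ[MvPolynomial (Fin 4) K] N,
      φ ∘ₗ dl K (n+1) = 0 →
      ∃ ψ : (Fin (rk n) → MvPolynomial (Fin 4) K) →ₗ[MvPolynomial (Fin 4) K] N,
        ψ ∘ₗ dl K n = φ := by
  have sq : ∀ n, ModuleCat.ofHom (dl K (n+1)) ≫ ModuleCat.ofHom (dl K n) = 0 := fun n => by
    rw [← ModuleCat.ofHom_comp, dl_sq]; rfl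
  have hπ : ModuleCat.ofHom (dl K 0) ≫ ModuleCat.ofHom (aug K I) = 0 := by
    have : aug K I ∘ₗ dl K 0 = 0 := LinearMap.ext fun w => (aug_iff hI _).2 ⟨w, rfl⟩
    exact ModuleCat.hom_ext this
  rw [ext_iff (fun n => ModuleCat.of _ (Fin (rk n) → MvPolynomial (Fin 4) K))
    (fun n => ModuleCat.ofHom (dl K n)) (fun n => ModuleCat.projective_of_free (Pi.basisFun _ _)) sq
    (fun n => (ShortComplex.moduleCat_exact_iff _).2 fun v hv => dl_ex n v hv)
    _ (ModuleCat.ofHom (aug K I)) hπ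
    ((ShortComplex.moduleCat_exact_iff _).2 fun v hv => (aug_iff hI v).1 hv)
    ((ModuleCat.epi_iff_surjective _).2 aug_surj)]
  constructor
  · intro h φ hφ
    obtain ⟨ψ, hψ⟩ := h (ModuleCat.ofHom φ) (by rw [← ModuleCat.ofHom_comp, hφ]; rfl)
    exact ⟨ψ.hom, congrArg ModuleCat.Hom.hom hψ⟩
  · intro h φ hφ
    obtain ⟨ψ, hψ⟩ := h φ.hom (congrArg ModuleCat.Hom.hom hφ)
    exact ⟨ModuleCat.ofHom ψ, by rw [← ModuleCat.ofHom_comp, hψ]; rfl⟩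

lemma rk_pos (n : ℕ) (h : n < 3) : 0 < rk (n+1) := by
  interval_cases n <;> decide

lemma pd (hI : I = Ideal.span {X 0 * X 1, X 0 * X 2, X 1 * X 3, X 2 * X 3}) :
    projDim (MvPolynomial (Fin 4) K)
        (ModuleCat.of (MvPolynomial (Fin 4) K) (MvPolynomial (Fin 4) K ⧸ I)) = (3 : ℕ∞) := by
  unfold projDim
  apply le_antisymm
  · apply sInf_le
    refine ⟨3, fun N => ?_, rfl⟩
    rw [ext_iff' hI]
    intro φ _
    refine ⟨0, LinearMap.ext fun v => ?_⟩
    have : v = 0 := funext fun i => i.elim0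
    rw [this, map_zero, map_zero]
  · apply le_sInf
    rintro _ ⟨n, hn, rfl⟩
    by_contra hlt
    have hlt : n < 3 := by
      have : (n : ℕ∞) < 3 := not_le.1 hlt
      exact_mod_cast this
    have h := hn (ModuleCat.of _
      (MvPolynomial (Fin 4) K ⧸ RingHom.ker (constantCoeff (σ := Fin 4) (R := K))))
    rw [ext_iff' hI] at h
    obtain ⟨ψ, hψ⟩ := h (Submodule.mkQ (RingHom.ker (constantCoeff (σ := Fin 4) (R := K))) ∘ₗ
        LinearMap.proj ⟨0, rk_pos n hlt⟩)
      (LinearMap.ext fun v => by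
        rw [LinearMap.comp_apply]; exact phi_zero _ _ (dl_min _ v))
    have h1 := LinearMap.congr_fun hψ (fun _ => 1)
    have h2 : (ψ ∘ₗ dl K n) (fun _ => 1) = 0 := phi_zero ψ _ (dl_min _ _)
    rw [h2] at h1
    have h3 := (Submodule.Quotient.mk_eq_zero
      (RingHom.ker (constantCoeff (σ := Fin 4) (R := K)))).1 h1.symm
    rw [RingHom.mem_ker] at h3
    simp at h3

end Alg

instance {n : ℕ} (L : Finset (Fin n → ℕ)) : Decidable (DominantSet L) := by
  unfold DominantSet; infer_instance

lemma dom_bound : ∀ L ∈ ({![1, 1, 0, 0], ![1, 0, 1, 0], ![0, 1, 0, 1], ![0, 0, 1, 1]} :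
    Finset (Fin 4 → ℕ)).powerset, DominantSet L → L.card ≤ 2 := by
  decide

/-- For `I = (ab, ac, bd, cd)` in `S = K[a,b,c,d]` (with minimal generating set `G` given
by the corresponding exponent vectors), `projdim (S/I) = 3` but the maximum cardinality
of a dominant subset of `G(I)` is `2`. -/
theorem example_pd_three_dominant_two (K : Type) [Field K]
    (I : Ideal (MvPolynomial (Fin 4) K))
    (hI : I = Ideal.span {X 0 * X 1, X 0 * X 2, X 1 * X 3, X 2 * X 3})
    (G : Finset (Fin 4 → ℕ))
    (hG : G = {![1, 1, 0, 0], ![1, 0, 1, 0], ![0, 1, 0, 1], ![0, 0, 1, 1]}) :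
    projDim (MvPolynomial (Fin 4) K)
        (ModuleCat.of (MvPolynomial (Fin 4) K) (MvPolynomial (Fin 4) K ⧸ I)) = (3 : ℕ∞) ∧
      (∃ L ⊆ G, DominantSet L ∧ L.card = 2) ∧
      (∀ L ⊆ G, DominantSet L → L.card ≤ 2) := by
  refine ⟨pd hI, ?_, ?_⟩
  · refine ⟨{![1, 1, 0, 0], ![0, 0, 1, 1]}, ?_, ?_, ?_⟩
    · subst hG; decide
    · decide
    · decide
  · intro L hL
    subst hG
    exact dom_bound L (Finset.mem_powerset.2 hL)
end
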